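/- arXiv:1803.01267 — 2 statements merged into one kernel-verified Lean document; each statement's English description precedes it below -/
import Mathlib

section
/- Let n ≥ 1 and let a ≠ a' be natural numbers. Let p, q ∈ MvPolynomial (Fin n) ℝ be harmonic, with p homogeneous of degree a and q homogeneous of degree a'. Then ∫_S (MvPolynomial.eval (fun i => x i) p) * (MvPolynomial.eval (fun i => x i) q) dμ(x) = 0. -/
open MvPolynomial MeasureTheory

theorem MvPolynomial.pderiv_pderiv_comm {σ R : Type*} [CommRing R] (i j : σ)
    (p : MvPolynomial σ R) : pderiv i (pderiv j p) = pderiv j (pderiv i p) := by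
  classical
  have h : ⁅pderiv (R := R) i, pderiv (R := R) j⁆ = 0 := by
    refine derivation_ext fun k => ?_
    simp only [Derivation.commutator_apply, pderiv_X, Pi.single_apply]
    split_ifs <;> simp
  have := DFunLike.congr_fun h p
  rwa [Derivation.commutator_apply, Derivation.zero_apply, sub_eq_zero] at this

/-- The infinitesimal rotation `xᵢ ∂ⱼ - xⱼ ∂ᵢ`, as a derivation of the polynomial ring. -/
noncomputable def MvPolynomial.angularDeriv {σ R : Type*} [CommRing R] (i j : σ) :
    Derivation R (MvPolynomial σ R) (MvPolynomial σ R) :=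
  (X i : MvPolynomial σ R) • pderiv j - (X j : MvPolynomial σ R) • pderiv i

theorem MvPolynomial.angularDeriv_apply {σ R : Type*} [CommRing R] (i j : σ)
    (p : MvPolynomial σ R) : angularDeriv i j p = X i * pderiv j p - X j * pderiv i p := by
  simp [angularDeriv]

theorem MvPolynomial.IsHomogeneous.sum_X_mul_pderiv_pderiv {σ R : Type*} [Fintype σ] [CommRing R]
    {p : MvPolynomial σ R} {a : ℕ} (hp : p.IsHomogeneous a) (i : σ) :
    ∑ j, X j * pderiv j (pderiv i p) = ((a : MvPolynomial σ R) - 1) * pderiv i p := by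
  classical
  have h := congrArg (pderiv i) hp.sum_X_mul_pderiv
  simp only [map_sum, pderiv_mul, pderiv_X, Pi.single_apply, nsmul_eq_mul,
    Finset.sum_add_distrib, ite_mul, one_mul, zero_mul, Finset.sum_ite_eq', Finset.mem_univ,
    if_true, Derivation.map_natCast] at h
  simp only [pderiv_pderiv_comm _ i]
  linear_combination h

/-- The angular Casimir operator acts on harmonic homogeneous polynomials of degree `a` in `n`
variables by a scalar multiple of `a (a + n - 2)`. -/
theorem MvPolynomial.IsHomogeneous.sum_angularDeriv_angularDeriv {σ R : Type*} [Fintype σ]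
    [CommRing R] {p : MvPolynomial σ R} {a : ℕ} (hp : p.IsHomogeneous a)
    (hΔ : ∑ i, pderiv i (pderiv i p) = 0) :
    ∑ i, ∑ j, angularDeriv i j (angularDeriv i j p) =
      (-2 * ((a : R) * (a + Fintype.card σ - 2))) • p := by
  classical
  have expand (i j : σ) : angularDeriv i j (angularDeriv i j p) =
      2 * (if i = j then X j * pderiv j p else 0) - X i * pderiv i p - X j * pderiv j p
      + X i ^ 2 * pderiv j (pderiv j p) + X j ^ 2 * pderiv i (pderiv i p)
      - 2 * (X i * (X j * pderiv j (pderiv i p))) := by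
    simp only [angularDeriv_apply, map_sub, pderiv_mul, pderiv_X, Pi.single_apply,
      pderiv_pderiv_comm i j]
    by_cases h : i = j
    · subst h; simp; ring
    · simp [h, Ne.symm h]; ring
  have euler : ∑ i, X i * pderiv i p = (a : MvPolynomial σ R) * p := by
    simpa using hp.sum_X_mul_pderiv
  have diag : ∑ i : σ, ∑ j, 2 * (if i = j then X j * pderiv j p else 0) = 2 * (a * p) := by
    simp [← Finset.mul_sum, euler]
  have left : ∑ i, ∑ _j : σ, X i * pderiv i p = Fintype.card σ * (a * p) := by
    rw [Finset.sum_comm]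
    simp [euler]
  have right : ∑ _i : σ, ∑ j, X j * pderiv j p = Fintype.card σ * (a * p) := by
    simp [euler]
  have radial : ∑ i : σ, ∑ j, X i ^ 2 * pderiv j (pderiv j p) = 0 := by
    simp [← Finset.mul_sum, hΔ]
  have radial' : ∑ i : σ, ∑ j, X j ^ 2 * pderiv i (pderiv i p) = 0 := by
    rw [Finset.sum_comm, radial]
  have cross : ∑ i, ∑ j, 2 * (X i * (X j * pderiv j (pderiv i p))) =
      2 * (((a : MvPolynomial σ R) - 1) * (a * p)) := by
    simp only [← Finset.mul_sum, hp.sum_X_mul_pderiv_pderiv, ← euler]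
    simp only [Finset.mul_sum, mul_left_comm]
  simp only [expand, Finset.sum_add_distrib, Finset.sum_sub_distrib, diag, left, right, radial,
    radial', cross, smul_eq_C_mul, map_mul, map_neg, map_sub, map_add, map_natCast, map_ofNat]
  ring

/-- A linear functional that is invariant under infinitesimal rotations annihilates the product of
two harmonic homogeneous polynomials, up to the difference of their Casimir eigenvalues. -/
theorem MvPolynomial.map_harmonic_mul_harmonic {σ R : Type*} [Fintype σ] [CommRing R]
    (Λ : MvPolynomial σ R →ₗ[R] R) (hΛ : ∀ i j f, Λ (angularDeriv i j f) = 0)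
    {p q : MvPolynomial σ R} {a b : ℕ} (hp : p.IsHomogeneous a) (hq : q.IsHomogeneous b)
    (hΔp : ∑ i, pderiv i (pderiv i p) = 0) (hΔq : ∑ i, pderiv i (pderiv i q) = 0) :
    2 * (((a : R) - b) * (a + b + Fintype.card σ - 2)) * Λ (p * q) = 0 := by
  have parts (i j : σ) : Λ (angularDeriv i j (angularDeriv i j p) * q) =
      Λ (p * angularDeriv i j (angularDeriv i j q)) := by
    have h := hΛ i j (angularDeriv i j p * q - p * angularDeriv i j q)
    simp only [map_sub, Derivation.leibniz, smul_eq_mul, map_add] at h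
    rw [mul_comm (angularDeriv i j (angularDeriv i j p)) q]
    rw [mul_comm (angularDeriv i j p)] at h
    linear_combination h
  have h : Λ ((∑ i, ∑ j, angularDeriv i j (angularDeriv i j p)) * q) =
      Λ (p * ∑ i, ∑ j, angularDeriv i j (angularDeriv i j q)) := by
    simp only [Finset.sum_mul, Finset.mul_sum, map_sum, parts]
  rw [hp.sum_angularDeriv_angularDeriv hΔp, hq.sum_angularDeriv_angularDeriv hΔq,
    smul_mul_assoc, mul_smul_comm, map_smul, map_smul, smul_eq_mul, smul_eq_mul] at h
  linear_combination -h

/-- Central projection onto the unit sphere of the facet `xᵢ = s` of a cube. -/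
noncomputable def EuclideanSpace.facetProj {m : ℕ} (i : Fin (m + 1)) (s : ℝ) (v : Fin m → ℝ) :
    EuclideanSpace ℝ (Fin (m + 1)) :=
  ‖WithLp.toLp 2 (i.insertNth s v : Fin (m + 1) → ℝ)‖⁻¹ •
    WithLp.toLp 2 (i.insertNth s v : Fin (m + 1) → ℝ)

theorem EuclideanSpace.contDiff_facetProj {m : ℕ} (i : Fin (m + 1)) {s : ℝ} (hs : s ≠ 0) :
    ContDiff ℝ 1 (facetProj (m := m) i s) := by
  have h : ContDiff ℝ 1 fun v : Fin m → ℝ =>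
      (WithLp.toLp 2 (i.insertNth s v : Fin (m + 1) → ℝ) : EuclideanSpace ℝ (Fin (m + 1))) := by
    rw [contDiff_euclidean]
    intro k
    induction k using i.succAboveCases with
    | x => simpa using contDiff_const
    | p j => simpa using contDiff_apply ℝ ℝ j
  have h0 (v : Fin m → ℝ) : WithLp.toLp 2 (i.insertNth s v : Fin (m + 1) → ℝ) ≠ 0 := by
    intro hv
    apply hs
    simpa using congrArg (fun x => x.ofLp i) hv
  exact ((h.norm ℝ h0).inv fun v => norm_ne_zero_iff.2 (h0 v)).smul h

theorem EuclideanSpace.sphere_subset_iUnion_facetProj (m : ℕ) :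
    {x : EuclideanSpace ℝ (Fin (m + 1)) | ‖x‖ = 1} ⊆
      ⋃ i, (facetProj i 1 '' Metric.closedBall 0 1 ∪
        facetProj i (-1) '' Metric.closedBall 0 1) := by
  intro x hx
  obtain ⟨i, hi⟩ := Finite.exists_max fun i => |x i|
  have hi0 : 0 < |x i| := by
    refine (abs_nonneg _).lt_of_ne fun h => ?_
    have : x = 0 := by
      ext k
      simpa using (hi k).trans_eq h.symm
    simp [this] at hx
  have key (s : ℝ) (hs : s = (x i) / |x i|) : x ∈ facetProj i s '' Metric.closedBall 0 1 := by
    refine ⟨fun j => x (i.succAbove j) / |x i|, ?_, ?_⟩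
    · rw [mem_closedBall_zero_iff, pi_norm_le_iff_of_nonneg zero_le_one]
      intro j
      rw [Real.norm_eq_abs, abs_div, abs_abs, div_le_one hi0]
      exact hi _
    · have hw : WithLp.toLp 2 (i.insertNth s (fun j => x (i.succAbove j) / |x i|) :
          Fin (m + 1) → ℝ) = |x i|⁻¹ • x := by
        ext k
        induction k using i.succAboveCases with
        | x => simp [hs, div_eq_inv_mul]
        | p j => simp [div_eq_inv_mul]
      rw [facetProj, hw, norm_smul, show ‖x‖ = 1 from hx, smul_smul]
      simp [hi0.ne']
  refine Set.mem_iUnion.2 ⟨i, ?_⟩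
  rcases abs_pos.1 hi0 |>.lt_or_gt with h | h
  · exact Or.inr (key _ (by rw [abs_of_neg h, div_neg, div_self h.ne]))
  · exact Or.inl (key _ (by rw [abs_of_pos h, div_self h.ne']))

theorem EuclideanSpace.hausdorffMeasure_unitSphere_lt_top {n : ℕ} (hn : 1 ≤ n) :
    Measure.hausdorffMeasure ((n : ℝ) - 1) {x : EuclideanSpace ℝ (Fin n) | ‖x‖ = 1} < ⊤ := by
  obtain ⟨m, rfl⟩ := Nat.exists_eq_add_of_le' hn
  rw [Nat.cast_add_one, add_sub_cancel_right]
  have cube : Measure.hausdorffMeasure (m : ℝ) (Metric.closedBall (0 : Fin m → ℝ) 1) < ⊤ := by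
    have := hausdorffMeasure_pi_real (ι := Fin m)
    rw [Fintype.card_fin] at this
    rw [this]
    exact measure_closedBall_lt_top
  have facet (i : Fin (m + 1)) (s : ℝ) (hs : s ≠ 0) : Measure.hausdorffMeasure (m : ℝ)
      (facetProj i s '' Metric.closedBall (0 : Fin m → ℝ) 1) < ⊤ := by
    obtain ⟨K, hK⟩ := (contDiff_facetProj i hs).contDiffOn.exists_lipschitzOnWith one_ne_zero
      (convex_closedBall (0 : Fin m → ℝ) 1) (isCompact_closedBall 0 1)
    refine (hK.hausdorffMeasure_image_le m.cast_nonneg).trans_lt (ENNReal.mul_lt_top ?_ cube)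
    exact ENNReal.rpow_lt_top_of_nonneg m.cast_nonneg ENNReal.coe_ne_top
  refine (measure_mono (sphere_subset_iUnion_facetProj m)).trans_lt ?_
  refine (measure_iUnion_fintype_le _ _).trans_lt (ENNReal.sum_lt_top.2 fun i _ => ?_)
  exact measure_union_lt_top (facet i 1 one_ne_zero) (facet i (-1) (by norm_num))

theorem MvPolynomial.hasDerivAt_eval {σ : Type*} [Fintype σ] (p : MvPolynomial σ ℝ)
    {c c' : ℝ → σ → ℝ} {t : ℝ} (hc : ∀ i, HasDerivAt (fun t => c t i) (c' t i) t) :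
    HasDerivAt (fun t => eval (c t) p) (∑ i, c' t i * eval (c t) (pderiv i p)) t := by
  classical
  induction p using MvPolynomial.induction_on with
  | C r => simpa using hasDerivAt_const t r
  | add p q hp hq =>
    simp only [map_add, mul_add, Finset.sum_add_distrib]
    exact hp.add hq
  | mul_X p i hp =>
    simp only [map_mul, eval_X]
    refine (hp.mul (hc i)).congr_deriv ?_
    simp [pderiv_X, Pi.single_apply, mul_add, Finset.sum_add_distrib, apply_ite, Finset.mul_sum,
      add_comm, mul_comm, mul_left_comm]

/-- Rotation by the angle `t` in the plane of the coordinates `i` and `j`. -/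
noncomputable def EuclideanSpace.planeRotation {n : ℕ} (i j : Fin n) (t : ℝ) :
    EuclideanSpace ℝ (Fin n) →ₗ[ℝ] EuclideanSpace ℝ (Fin n) where
  toFun x := x + ((Real.cos t - 1) * x i - Real.sin t * x j) • EuclideanSpace.single i 1 +
    (Real.sin t * x i + (Real.cos t - 1) * x j) • EuclideanSpace.single j 1
  map_add' x y := by ext k; simp; split_ifs <;> ring
  map_smul' r x := by ext k; simp; split_ifs <;> ring

theorem EuclideanSpace.planeRotation_apply {n : ℕ} (i j : Fin n) (t : ℝ)
    (x : EuclideanSpace ℝ (Fin n)) (k : Fin n) :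
    planeRotation i j t x k = x k +
      ((Real.cos t - 1) * x i - Real.sin t * x j) * (if k = i then 1 else 0) +
      (Real.sin t * x i + (Real.cos t - 1) * x j) * (if k = j then 1 else 0) := by
  simp [planeRotation]

theorem EuclideanSpace.planeRotation_zero {n : ℕ} (i j : Fin n) (x : EuclideanSpace ℝ (Fin n)) :
    planeRotation i j 0 x = x := by
  ext k
  simp [planeRotation_apply]

theorem EuclideanSpace.norm_planeRotation {n : ℕ} {i j : Fin n} (hij : i ≠ j) (t : ℝ)
    (x : EuclideanSpace ℝ (Fin n)) : ‖planeRotation i j t x‖ = ‖x‖ := by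
  have h : ‖planeRotation i j t x‖ ^ 2 = ‖x‖ ^ 2 := by
    simp only [planeRotation, LinearMap.coe_mk, AddHom.coe_mk]
    rw [norm_add_sq_real, norm_add_sq_real, inner_add_left]
    simp only [inner_smul_left, inner_smul_right, norm_smul, mul_pow,
      EuclideanSpace.inner_single_right]
    simp [hij.symm]
    linear_combination (x i ^ 2 + x j ^ 2) * Real.sin_sq_add_cos_sq t
  exact (sq_eq_sq₀ (norm_nonneg _) (norm_nonneg _)).1 h

/-- Rotation in a coordinate plane, as a linear isometric automorphism. -/
noncomputable def EuclideanSpace.planeRotationEquiv {n : ℕ} {i j : Fin n} (hij : i ≠ j) (t : ℝ) :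
    EuclideanSpace ℝ (Fin n) ≃ₗᵢ[ℝ] EuclideanSpace ℝ (Fin n) :=
  LinearIsometry.toLinearIsometryEquiv ⟨planeRotation i j t, norm_planeRotation hij t⟩ rfl

theorem LinearIsometryEquiv.setIntegral_unitSphere_comp {E : Type*} [NormedAddCommGroup E]
    [NormedSpace ℝ E] [MeasurableSpace E] [BorelSpace E] (e : E ≃ₗᵢ[ℝ] E) (d : ℝ) (f : E → ℝ) :
    ∫ x in {x : E | ‖x‖ = 1}, f (e x) ∂Measure.hausdorffMeasure d =
      ∫ x in {x : E | ‖x‖ = 1}, f x ∂Measure.hausdorffMeasure d := by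
  have h := (e.toIsometryEquiv.measurePreserving_hausdorffMeasure d).setIntegral_preimage_emb
    e.toHomeomorph.measurableEmbedding f {x : E | ‖x‖ = 1}
  simpa using h

theorem EuclideanSpace.continuous_eval {n : ℕ} (p : MvPolynomial (Fin n) ℝ) :
    Continuous fun x : EuclideanSpace ℝ (Fin n) => eval (fun i => x i) p :=
  (MvPolynomial.continuous_eval p).comp (by fun_prop)

theorem EuclideanSpace.isCompact_unitSphere (n : ℕ) :
    IsCompact {x : EuclideanSpace ℝ (Fin n) | ‖x‖ = 1} := by
  simpa [Metric.sphere] using isCompact_sphere (0 : EuclideanSpace ℝ (Fin n)) 1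

theorem EuclideanSpace.integrableOn_unitSphere_eval {n : ℕ} (hn : 1 ≤ n)
    (p : MvPolynomial (Fin n) ℝ) :
    IntegrableOn (fun x : EuclideanSpace ℝ (Fin n) => eval (fun i => x i) p) {x | ‖x‖ = 1}
      (Measure.hausdorffMeasure ((n : ℝ) - 1)) :=
  (EuclideanSpace.continuous_eval p).continuousOn.integrableOn_of_subset_isCompact
    (isCompact_unitSphere n) (isCompact_unitSphere n).measurableSet subset_rfl
    (hausdorffMeasure_unitSphere_lt_top hn).ne

theorem EuclideanSpace.setIntegral_unitSphere_angularDeriv {n : ℕ} (hn : 1 ≤ n) (i j : Fin n)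
    (p : MvPolynomial (Fin n) ℝ) :
    ∫ x : EuclideanSpace ℝ (Fin n) in {x | ‖x‖ = 1}, eval (fun k => x k) (angularDeriv i j p)
      ∂Measure.hausdorffMeasure ((n : ℝ) - 1) = 0 := by
  rcases eq_or_ne i j with rfl | hij
  · simp [angularDeriv_apply]
  set μ := (Measure.hausdorffMeasure ((n : ℝ) - 1)).restrict
    {x : EuclideanSpace ℝ (Fin n) | ‖x‖ = 1}
  have : IsFiniteMeasure μ := ⟨by simpa [μ] using hausdorffMeasure_unitSphere_lt_top hn⟩
  have hmem : ∀ᵐ x ∂μ, ‖x‖ = 1 := ae_restrict_mem (isCompact_unitSphere n).measurableSet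
  obtain ⟨C, hC⟩ := (isCompact_unitSphere n).exists_bound_of_continuousOn
    (EuclideanSpace.continuous_eval (angularDeriv i j p)).continuousOn
  have hderiv (x : EuclideanSpace ℝ (Fin n)) (t : ℝ) :
      HasDerivAt (fun t => eval (fun k => planeRotation i j t x k) p)
        (eval (fun k => planeRotation i j t x k) (angularDeriv i j p)) t := by
    convert MvPolynomial.hasDerivAt_eval p (c := fun t k => planeRotation i j t x k)
      (c' := fun t k => (-Real.sin t * x i - Real.cos t * x j) * (if k = i then 1 else 0) +
        (Real.cos t * x i - Real.sin t * x j) * (if k = j then 1 else 0)) (t := t) ?_ using 1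
    · simp only [add_mul, Finset.sum_add_distrib, mul_ite, ite_mul, mul_one, mul_zero, zero_mul,
        Finset.sum_ite_eq', Finset.mem_univ, if_true, angularDeriv_apply, map_sub, map_mul, eval_X]
      simp only [planeRotation_apply, hij, hij.symm, if_true, if_false]
      ring
    · intro k
      simp only [planeRotation_apply]
      have hs := Real.hasDerivAt_sin t
      have hc := Real.hasDerivAt_cos t
      refine HasDerivAt.congr_deriv (((((hc.sub_const 1).mul_const (x i)).sub
        (hs.mul_const (x j))).mul_const (if k = i then 1 else 0)).const_add (x k) |>.add
        (((hs.mul_const (x i)).add ((hc.sub_const 1).mul_const (x j))).mul_const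
        (if k = j then 1 else 0))) ?_
      ring
  have hmain := (hasDerivAt_integral_of_dominated_loc_of_deriv_le (μ := μ) (x₀ := (0 : ℝ))
    (F := fun t x => eval (fun k => planeRotation i j t x k) p)
    (F' := fun t x => eval (fun k => planeRotation i j t x k) (angularDeriv i j p))
    (bound := fun _ => C) Filter.univ_mem
    (.of_forall fun t => ((EuclideanSpace.continuous_eval p).comp
      (planeRotation i j t).continuous_of_finiteDimensional).aestronglyMeasurable)
    ?_ ((EuclideanSpace.continuous_eval _).comp
      (planeRotation i j 0).continuous_of_finiteDimensional).aestronglyMeasurable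
    ?_ (integrable_const C) (.of_forall fun x t _ => hderiv x t)).2
  · have hconst (t : ℝ) : ∫ x, eval (fun k => planeRotation i j t x k) p ∂μ =
        ∫ x, eval (fun k => x k) p ∂μ :=
      (planeRotationEquiv hij t).setIntegral_unitSphere_comp _ fun x => eval (fun k => x k) p
    simp only [hconst] at hmain
    simpa only [planeRotation_zero] using hmain.unique (hasDerivAt_const _ _)
  · have := integrableOn_unitSphere_eval hn p
    simpa only [planeRotation_zero, IntegrableOn] using this
  · filter_upwards [hmem] with x hx t _
    exact hC _ ((norm_planeRotation hij t x).trans hx)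

/-- Integration of polynomials over the unit sphere. -/
noncomputable def EuclideanSpace.sphereIntegral {n : ℕ} (hn : 1 ≤ n) :
    MvPolynomial (Fin n) ℝ →ₗ[ℝ] ℝ where
  toFun p := ∫ x : EuclideanSpace ℝ (Fin n) in {x | ‖x‖ = 1}, eval (fun k => x k) p
    ∂Measure.hausdorffMeasure ((n : ℝ) - 1)
  map_add' p q := by
    simpa using integral_add (integrableOn_unitSphere_eval hn p) (integrableOn_unitSphere_eval hn q)
  map_smul' r p := by
    simpa using integral_const_mul r _

theorem MvPolynomial.IsHomogeneous.setIntegral_unitSphere_eq_zero {n a : ℕ} (ha : Odd a)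
    {p : MvPolynomial (Fin n) ℝ} (hp : p.IsHomogeneous a) (d : ℝ) :
    ∫ x : EuclideanSpace ℝ (Fin n) in {x | ‖x‖ = 1}, eval (fun k => x k) p
      ∂Measure.hausdorffMeasure d = 0 := by
  have h := (LinearIsometryEquiv.neg ℝ).setIntegral_unitSphere_comp d
    fun x : EuclideanSpace ℝ (Fin n) => eval (fun k => x k) p
  have hneg (x : EuclideanSpace ℝ (Fin n)) :
      eval (fun k => (-x) k) p = -eval (fun k => x k) p := by
    rw [eval_eq', eval_eq', ← Finset.sum_neg_distrib]
    refine Finset.sum_congr rfl fun d hd => ?_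
    have hda : ∑ i, d i = a := by
      rw [← Finsupp.degree_eq_sum, Finsupp.degree_eq_weight_one]
      exact hp (mem_support_iff.1 hd)
    simp [neg_pow (x _), Finset.prod_mul_distrib, Finset.prod_pow_eq_pow_sum, hda, ha.neg_one_pow]
  simp only [LinearIsometryEquiv.coe_neg, hneg, integral_neg] at h
  linarith

/-- Harmonic polynomials that are homogeneous of different degrees are orthogonal in
`L²` of the unit sphere `S^{n-1}` with respect to the `(n−1)`-dimensional Hausdorff measure. -/
theorem harmonic_homogeneous_orthogonal (n a a' : ℕ) (hn : 1 ≤ n) (hne : a ≠ a')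
    (p q : MvPolynomial (Fin n) ℝ)
    (hp : p ∈ homogeneousSubmodule (Fin n) ℝ a)
    (hp' : (∑ i, pderiv i (pderiv i p)) = 0)
    (hq : q ∈ homogeneousSubmodule (Fin n) ℝ a')
    (hq' : (∑ i, pderiv i (pderiv i q)) = 0) :
    ∫ x : EuclideanSpace ℝ (Fin n) in {x : EuclideanSpace ℝ (Fin n) | ‖x‖ = 1},
        (MvPolynomial.eval (fun i => x i) p) * (MvPolynomial.eval (fun i => x i) q)
        ∂(Measure.hausdorffMeasure ((n : ℝ) - 1)) = 0 := by
  rw [mem_homogeneousSubmodule] at hp hq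
  simp only [← map_mul]
  by_cases hodd : a + a' = 1
  · exact (hp.mul hq).setIntegral_unitSphere_eq_zero (hodd ▸ odd_one) _
  · have h := map_harmonic_mul_harmonic (EuclideanSpace.sphereIntegral hn)
      (EuclideanSpace.setIntegral_unitSphere_angularDeriv hn) hp hq hp' hq'
    rw [Fintype.card_fin] at h
    refine (mul_eq_zero.1 h).resolve_left (mul_ne_zero two_ne_zero (mul_ne_zero ?_ ?_))
    · exact sub_ne_zero.2 (Nat.cast_injective.ne hne)
    · have : (3 : ℝ) ≤ a + a' + n := by exact_mod_cast (by omega : 3 ≤ a + a' + n)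
      linarith
end

section
/- Let n ≥ 2 and b, c ≥ 0 be natural numbers, let e₀ = Pi.single 0 1 : Fin n → ℂ, and let Z be the ℂ-submodule of MvPolynomial (Fin n ⊕ Fin n) ℂ consisting of those □-harmonic polynomials P bihomogeneous of bidegree (b, c) such that for every A ∈ Matrix.unitaryGroup (Fin n) ℂ with A.mulVec e₀ = e₀ and every v : Fin n → ℂ, the evaluation of P at the assignment Sum.inl j ↦ (A.mulVec v) j, Sum.inr j ↦ star ((A.mulVec v) j) equals the evaluation of P at the assignment Sum.inl j ↦ v j, Sum.inr j ↦ star (v j). Then Module.finrank ℂ Z = 1. -/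
open MvPolynomial

/-- The space of zonal `□`-harmonic polynomials of bidegree `(b, c)`: polynomials in the
variables `z_j = X (Sum.inl j)` and `w_j = X (Sum.inr j)` (thought of as `z̄_j`) that are
`□`-harmonic, bihomogeneous of bidegree `(b, c)`, and invariant under all unitary matrices
fixing the vector `e` (acting on `(v, star v)`). -/
noncomputable def zonalBiharmonic (n b c : ℕ) (e : Fin n → ℂ) :
    Submodule ℂ (MvPolynomial (Fin n ⊕ Fin n) ℂ) where
  carrier := {P |
    P ∈ weightedHomogeneousSubmodule ℂ (Sum.elim (fun _ => 1) fun _ => 0) b ∧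
    P ∈ weightedHomogeneousSubmodule ℂ (Sum.elim (fun _ => 0) fun _ => 1) c ∧
    (∑ j, pderiv (Sum.inl j) (pderiv (Sum.inr j) P)) = 0 ∧
    ∀ A ∈ Matrix.unitaryGroup (Fin n) ℂ, A.mulVec e = e →
      ∀ v : Fin n → ℂ,
        MvPolynomial.eval (Sum.elim (A.mulVec v) fun j => star ((A.mulVec v) j)) P =
          MvPolynomial.eval (Sum.elim v fun j => star (v j)) P}
  zero_mem' := by
    refine ⟨Submodule.zero_mem _, Submodule.zero_mem _, by simp, ?_⟩
    intro A hA hAe v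
    simp
  add_mem' := by
    rintro P Q ⟨hP1, hP2, hP3, hP4⟩ ⟨hQ1, hQ2, hQ3, hQ4⟩
    refine ⟨Submodule.add_mem _ hP1 hQ1, Submodule.add_mem _ hP2 hQ2, ?_, ?_⟩
    · simp only [map_add, Finset.sum_add_distrib, hP3, hQ3, add_zero]
    · intro A hA hAe v
      simp only [map_add, hP4 A hA hAe v, hQ4 A hA hAe v]
  smul_mem' := by
    rintro d P ⟨hP1, hP2, hP3, hP4⟩
    refine ⟨Submodule.smul_mem _ d hP1, Submodule.smul_mem _ d hP2, ?_, ?_⟩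
    · have h : ∀ j : Fin n, pderiv (Sum.inl j) (pderiv (Sum.inr j) (d • P)) =
          d • pderiv (Sum.inl j) (pderiv (Sum.inr j) P) := by
        intro j
        rw [Derivation.map_smul, Derivation.map_smul]
      rw [Finset.sum_congr rfl (fun j _ => h j), ← Finset.smul_sum, hP3, smul_zero]
    · intro A hA hAe v
      simp only [MvPolynomial.smul_eval, hP4 A hA hAe v]

section ZonalForms

variable {ι : Type*}

/-- A polynomial in `z` and `w` vanishing wherever `w = star z` is zero. -/
theorem eq_zero_of_eval_star_eq_zero {P : MvPolynomial (ι ⊕ ι) ℂ}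
    (h : ∀ v : ι → ℂ, eval (Sum.elim v fun j => star (v j)) P = 0) : P = 0 := by
  let Q : MvPolynomial (ι ⊕ ι) ℂ := bind₁ (Sum.elim
    (fun j => X (Sum.inl j) + C Complex.I * X (Sum.inr j))
    (fun j => X (Sum.inl j) - C Complex.I * X (Sum.inr j))) P
  have hQ : Q = 0 := by
    refine funext_set (fun _ => Set.range ((↑) : ℝ → ℂ))
      (fun _ => Set.infinite_range_of_injective Complex.ofReal_injective) fun x hx => ?_
    rw [map_zero, ← h fun j => x (Sum.inl j) + Complex.I * x (Sum.inr j)]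
    have hx' : ∀ i, star (x i) = x i := fun i => by
      obtain ⟨r, hr⟩ := hx i (Set.mem_univ _)
      simp [← hr]
    simp only [Q, eval, eval₂Hom_bind₁]
    congr 2
    ext i
    rcases i with i | i <;> simp [← starRingEnd_apply] at hx' ⊢
    simp [hx', sub_eq_add_neg]
  refine MvPolynomial.funext fun x => ?_
  have := congrArg (eval (Sum.elim (fun j => (x (Sum.inl j) + x (Sum.inr j)) / 2)
    (fun j => (x (Sum.inl j) - x (Sum.inr j)) / (2 * Complex.I)))) hQ
  rw [map_zero] at this ⊢
  rw [← this]
  simp only [Q, eval, eval₂Hom_bind₁]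
  congr 2
  ext i
  rcases i with i | i <;> simp <;> field_simp <;> ring

variable [Fintype ι]

/-- The polynomial `P` with each variable `X i` replaced by `μ i * X i`. -/
noncomputable def scaleVariables (μ : ι ⊕ ι → ℂ) (P : MvPolynomial (ι ⊕ ι) ℂ) :
    MvPolynomial (ι ⊕ ι) ℂ :=
  ∑ m ∈ P.support, monomial m (P.coeff m * ∏ i, μ i ^ m i)

theorem eval_scaleVariables (μ x : ι ⊕ ι → ℂ) (P : MvPolynomial (ι ⊕ ι) ℂ) :
    eval x (scaleVariables μ P) = eval (fun i => μ i * x i) P := by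
  rw [scaleVariables, map_sum, eval_eq']
  simp [eval_monomial, Finsupp.prod_fintype, mul_pow, Finset.prod_mul_distrib, mul_assoc]

variable [DecidableEq ι]

/-- The form `∑ j ≠ o, z_j * w_j`. -/
noncomputable def offAxisForm (o : ι) : MvPolynomial (ι ⊕ ι) ℂ :=
  ∑ j ∈ Finset.univ.erase o, X (Sum.inl j) * X (Sum.inr j)

/-- The polynomial `z_o ^ p * w_o ^ q * (∑ j ≠ o, z_j * w_j) ^ k`. -/
noncomputable def zonalMonomial (o : ι) (p q k : ℕ) : MvPolynomial (ι ⊕ ι) ℂ :=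
  X (Sum.inl o) ^ p * X (Sum.inr o) ^ q * offAxisForm o ^ k

theorem pderiv_inl_offAxisForm (o j : ι) :
    pderiv (Sum.inl j) (offAxisForm o) = if j = o then 0 else X (Sum.inr j) := by
  simp only [offAxisForm, map_sum, Derivation.leibniz, pderiv_X, smul_eq_mul]
  simp [Pi.single_apply]

theorem pderiv_inr_offAxisForm (o j : ι) :
    pderiv (Sum.inr j) (offAxisForm o) = if j = o then 0 else X (Sum.inl j) := by
  simp only [offAxisForm, map_sum, Derivation.leibniz, pderiv_X, smul_eq_mul]
  simp [Pi.single_apply]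

theorem laplacian_zonalMonomial (o : ι) (p q k : ℕ) :
    ∑ j, pderiv (Sum.inl j) (pderiv (Sum.inr j) (zonalMonomial o p q k)) =
      C ((p * q : ℕ) : ℂ) * zonalMonomial o (p - 1) (q - 1) k +
        C ((k * (k - 1 + (Fintype.card ι - 1)) : ℕ) : ℂ) * zonalMonomial o p q (k - 1) := by
  rw [← Finset.add_sum_erase _ _ (Finset.mem_univ o)]
  have h : ∀ j ∈ Finset.univ.erase o,
      pderiv (Sum.inl j) (pderiv (Sum.inr j) (zonalMonomial o p q k)) =
        X (Sum.inl o) ^ p * X (Sum.inr o) ^ q *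
          (((k * (k - 1) : ℕ) : MvPolynomial (ι ⊕ ι) ℂ) * offAxisForm o ^ (k - 1 - 1)) *
          (X (Sum.inl j) * X (Sum.inr j)) +
        X (Sum.inl o) ^ p * X (Sum.inr o) ^ q *
          ((k : MvPolynomial (ι ⊕ ι) ℂ) * offAxisForm o ^ (k - 1)) := by
    intro j hj
    have hj : j ≠ o := Finset.ne_of_mem_erase hj
    simp [zonalMonomial, Derivation.leibniz, Derivation.leibniz_pow, pderiv_X,
      pderiv_inl_offAxisForm, pderiv_inr_offAxisForm, hj, hj.symm]
    ring
  rw [Finset.sum_congr rfl h, Finset.sum_add_distrib, ← Finset.mul_sum, ← offAxisForm,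
    Finset.sum_const, Finset.card_erase_of_mem (Finset.mem_univ o), Finset.card_univ]
  simp [zonalMonomial, Derivation.leibniz, Derivation.leibniz_pow, pderiv_X,
      pderiv_inl_offAxisForm, pderiv_inr_offAxisForm]
  rcases k with _ | _ | k <;> simp <;> ring

/-- The combination with coefficients `a` of the zonal monomials of bidegree `(b, c)`. -/
noncomputable def zonalSum (o : ι) (b c : ℕ) (a : ℕ → ℂ) : MvPolynomial (ι ⊕ ι) ℂ :=
  ∑ k ∈ Finset.range (min b c + 1), C (a k) * zonalMonomial o (b - k) (c - k) k

theorem laplacian_zonalSum (o : ι) (b c : ℕ) (a : ℕ → ℂ) :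
    ∑ j, pderiv (Sum.inl j) (pderiv (Sum.inr j) (zonalSum o b c a)) =
      ∑ k ∈ Finset.range (min b c),
        C (a k * ((b - k) * (c - k) : ℕ) +
            a (k + 1) * (((k + 1) * (k + (Fintype.card ι - 1)) : ℕ) : ℂ)) *
          zonalMonomial o (b - (k + 1)) (c - (k + 1)) k := by
  have h : (b - min b c) * (c - min b c) = 0 := by
    rcases le_total b c with h | h <;> simp [h]
  simp only [zonalSum, map_sum, pderiv_C_mul]
  rw [Finset.sum_comm]
  simp only [← Finset.mul_sum, laplacian_zonalMonomial, mul_add, Finset.sum_add_distrib,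
    map_add, add_mul]
  rw [Finset.sum_range_succ, Finset.sum_range_succ' (fun k => C (a k) * (C _ * _))]
  simp [h, mul_assoc, Nat.sub_sub, -Nat.cast_mul, -Nat.cast_add]
  exact Finset.sum_congr rfl fun k _ => by push_cast; ring

theorem eq_zero_of_sum_zonalMonomial_eq_zero {o j : ι} (hj : j ≠ o) {N : ℕ} {p q : ℕ → ℕ}
    {d : ℕ → ℂ} (h : ∑ k ∈ Finset.range N, C (d k) * zonalMonomial o (p k) (q k) k = 0)
    {k : ℕ} (hk : k < N) : d k = 0 := by
  let f : ι ⊕ ι → Polynomial ℂ := Sum.elim (fun i => if i = o ∨ i = j then 1 else 0)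
    (fun i => if i = o then 1 else if i = j then Polynomial.X else 0)
  have hf : aeval f (offAxisForm o) = Polynomial.X := by
    rw [offAxisForm, map_sum, Finset.sum_eq_single_of_mem j (by simp [hj])]
    · simp [f, hj]
    · intro i hi hij
      simp [f, hij, Finset.ne_of_mem_erase hi]
  have h' := congrArg (fun P => (aeval f P).coeff k) h
  simp only [zonalMonomial, map_sum, map_mul, map_pow, hf, aeval_X, aeval_C] at h'
  simpa [f, hk, Polynomial.finsetSum_coeff, Polynomial.coeff_X_pow, ← Polynomial.C_eq_algebraMap]
    using h'

theorem isWeightedHomogeneous_zonalSum (o : ι) (b c α β : ℕ) (a : ℕ → ℂ) :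
    IsWeightedHomogeneous (Sum.elim (fun _ => α) fun _ => β : ι ⊕ ι → ℕ) (zonalSum o b c a)
      (b * α + c * β) := by
  have hX := isWeightedHomogeneous_X ℂ (Sum.elim (fun _ => α) fun _ => β : ι ⊕ ι → ℕ)
  have hr : IsWeightedHomogeneous (Sum.elim (fun _ => α) fun _ => β : ι ⊕ ι → ℕ)
      (offAxisForm o) (α + β) := .sum _ _ _ fun i _ => (hX (Sum.inl i)).mul (hX (Sum.inr i))
  refine IsWeightedHomogeneous.sum _ _ _ fun k hk => ?_
  have hk : k ≤ min b c := Nat.lt_succ_iff.1 (Finset.mem_range.1 hk)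
  have hdeg : b * α + c * β = 0 + ((b - k) • α + (c - k) • β + k • (α + β)) := by
    obtain ⟨b, rfl⟩ := Nat.exists_eq_add_of_le (hk.trans (min_le_left _ _))
    obtain ⟨c, rfl⟩ := Nat.exists_eq_add_of_le (hk.trans (min_le_right _ _))
    simp
    ring
  rw [hdeg]
  exact (isWeightedHomogeneous_C _ (a k)).mul
    ((((hX (Sum.inl o)).pow (b - k)).mul ((hX (Sum.inr o)).pow (c - k))).mul (hr.pow k))

theorem eval_offAxisForm (o : ι) (v : ι → ℂ) :
    eval (Sum.elim v fun j => star (v j)) (offAxisForm o) = v ⬝ᵥ star v - v o * star (v o) := by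
  rw [dotProduct, ← Finset.add_sum_erase _ _ (Finset.mem_univ o)]
  simp [offAxisForm]

theorem mulVec_apply_of_fixes {A : Matrix ι ι ℂ} (hA : A ∈ Matrix.unitaryGroup ι ℂ) {o : ι}
    (hAo : A.mulVec (Pi.single o 1) = Pi.single o 1) (v : ι → ℂ) : A.mulVec v o = v o := by
  have h : (star A).mulVec (Pi.single o 1) = Pi.single o 1 := by
    nth_rw 1 [← hAo]
    rw [Matrix.mulVec_mulVec, Matrix.mem_unitaryGroup_iff'.1 hA, Matrix.one_mulVec]
  have h' : A o = Pi.single o 1 := by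
    ext i
    simpa [Matrix.star_apply, Pi.single_apply, apply_ite star, ← star_eq_iff_star_eq, eq_comm]
      using congrArg star (congrFun h i)
  simp [Matrix.mulVec, h']

theorem eval_zonalSum_mulVec {A : Matrix ι ι ℂ} (hA : A ∈ Matrix.unitaryGroup ι ℂ) {o : ι}
    (hAo : A.mulVec (Pi.single o 1) = Pi.single o 1) (b c : ℕ) (a : ℕ → ℂ) (v : ι → ℂ) :
    eval (Sum.elim (A.mulVec v) fun j => star (A.mulVec v j)) (zonalSum o b c a) =
      eval (Sum.elim v fun j => star (v j)) (zonalSum o b c a) := by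
  have h : A.mulVec v ⬝ᵥ star (A.mulVec v) = v ⬝ᵥ star v := by
    rw [Matrix.star_mulVec, dotProduct_comm, Matrix.dotProduct_mulVec, Matrix.vecMul_vecMul,
      ← Matrix.star_eq_conjTranspose, Matrix.mem_unitaryGroup_iff'.1 hA, Matrix.vecMul_one,
      dotProduct_comm]
  simp only [zonalSum, zonalMonomial, map_sum, map_mul, map_pow, eval_offAxisForm, h, eval_X,
    Sum.elim_inl, Sum.elim_inr, mulVec_apply_of_fixes hA hAo, eval_C]

/-- The stabilizer of the basis vector at `o` moves every vector into the span of the basis vectors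
at `o` and `j`. -/
theorem exists_unitary_mulVec_eq {o j : ι} (hj : j ≠ o) (v : ι → ℂ) :
    ∃ A ∈ Matrix.unitaryGroup ι ℂ, A.mulVec (Pi.single o 1) = Pi.single o 1 ∧
      ∃ s : ℝ, A.mulVec (Pi.single o (v o) + Pi.single j (s : ℂ)) = v := by
  let w : EuclideanSpace ℂ ι := WithLp.toLp 2 (v - Pi.single o (v o))
  by_cases hw : w = 0
  · refine ⟨1, one_mem _, Matrix.one_mulVec _, 0, ?_⟩
    have : v - Pi.single o (v o) = 0 := congrArg WithLp.ofLp hw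
    rw [Matrix.one_mulVec, Complex.ofReal_zero, Pi.single_zero, add_zero, sub_eq_zero.1 this]
    simp
  let u : ι → EuclideanSpace ℂ ι := fun i =>
    if i = o then EuclideanSpace.single o 1 else ((‖w‖ : ℂ)⁻¹ • w)
  have hw' : ‖w‖ ≠ 0 := by simpa using hw
  have huo : u o = EuclideanSpace.single o 1 := if_pos rfl
  have huj : u j = (‖w‖ : ℂ)⁻¹ • w := if_neg hj
  have hinner : inner ℂ (u o) (u j) = 0 := by
    simp [huo, huj, w, EuclideanSpace.inner_single_left]
  have hu : Orthonormal ℂ (({o, j} : Set ι).domRestrict u) := by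
    constructor
    · rintro ⟨x, rfl | rfl⟩
      · simp [Set.domRestrict, huo]
      · simp [Set.domRestrict, huj, norm_smul, hw']
    · rintro ⟨x, rfl | rfl⟩ ⟨y, rfl | rfl⟩ hxy
      · exact absurd rfl hxy
      · exact hinner
      · exact inner_eq_zero_symm.1 hinner
      · exact absurd rfl hxy
  obtain ⟨B, hB⟩ := hu.exists_orthonormalBasis_extension_of_card_eq (by simp)
  let A : Matrix ι ι ℂ := (EuclideanSpace.basisFun ι ℂ).toBasis.toMatrix B
  have hAs : ∀ i (t : ℂ), A.mulVec (Pi.single i t) = WithLp.ofLp (t • B i) := fun i t => by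
    ext k
    simp [A, Module.Basis.toMatrix_apply, mul_comm]
  have ho : B o = EuclideanSpace.single o 1 := (hB o (by simp)).trans huo
  have hj' : B j = (‖w‖ : ℂ)⁻¹ • w := (hB j (by simp)).trans huj
  refine ⟨A, (EuclideanSpace.basisFun ι ℂ).toMatrix_orthonormalBasis_mem_unitary B, ?_, ‖w‖, ?_⟩
  · simp [hAs, ho]
  · rw [Matrix.mulVec_add, hAs, hAs, ho, hj', smul_inv_smul₀ (by exact_mod_cast hw')]
    ext i
    simp [w, Pi.single_apply]

theorem coeff_scaleVariables (μ : ι ⊕ ι → ℂ) (P : MvPolynomial (ι ⊕ ι) ℂ) (m : ι ⊕ ι →₀ ℕ) :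
    (scaleVariables μ P).coeff m = P.coeff m * ∏ i, μ i ^ m i := by
  simp +contextual [scaleVariables, coeff_sum, coeff_monomial]

/-- Invariance of `v ↦ P (v, star v)` under the unitary matrices fixing the basis vector at `o`. -/
def IsStabilizerInvariant (o : ι) (P : MvPolynomial (ι ⊕ ι) ℂ) : Prop :=
  ∀ A ∈ Matrix.unitaryGroup ι ℂ, A.mulVec (Pi.single o 1) = Pi.single o 1 → ∀ v : ι → ℂ,
    eval (Sum.elim (A.mulVec v) fun j => star (A.mulVec v j)) P =
      eval (Sum.elim v fun j => star (v j)) P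

theorem IsStabilizerInvariant.inl_eq_inr {o j : ι} (hj : j ≠ o) {P : MvPolynomial (ι ⊕ ι) ℂ}
    (hP : IsStabilizerInvariant o P) {m : ι ⊕ ι →₀ ℕ} (hm : m ∈ P.support) :
    m (Sum.inl j) = m (Sum.inr j) := by
  let N := m (Sum.inl j) + m (Sum.inr j) + 1
  have hζ := Complex.isPrimitiveRoot_exp N (Nat.succ_ne_zero _)
  set ζ := Complex.exp (2 * Real.pi * Complex.I / N)
  have hζ1 : ζ * star ζ = 1 := by
    simpa [hζ.norm'_eq_one (Nat.succ_ne_zero _)] using Complex.mul_conj' ζ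
  let d : ι → ℂ := fun i => if i = j then ζ else 1
  have hd : ∀ i, d i * star (d i) = 1 := fun i => by
    by_cases h : i = j <;> simp only [d, h, if_true, if_false, hζ1, star_one, mul_one]
  have hA : Matrix.diagonal d ∈ Matrix.unitaryGroup ι ℂ := by
    rw [Matrix.mem_unitaryGroup_iff, Matrix.star_eq_conjTranspose,
      Matrix.diagonal_conjTranspose, Matrix.diagonal_mul_diagonal, ← Matrix.diagonal_one]
    exact congrArg _ (funext hd)
  have hAo : (Matrix.diagonal d).mulVec (Pi.single o 1) = Pi.single o 1 := by
    ext i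
    by_cases h : i = o
    · simp [h, d, hj.symm, Matrix.mulVec_diagonal]
    · simp [h, Matrix.mulVec_diagonal]
  have hscale : scaleVariables (Sum.elim d fun i => star (d i)) P = P := by
    rw [← sub_eq_zero]
    refine eq_zero_of_eval_star_eq_zero fun v => ?_
    rw [map_sub, eval_scaleVariables, ← hP _ hA hAo v, sub_eq_zero]
    congr 2
    ext i
    rcases i with i | i <;> simp [Matrix.mulVec_diagonal]
  have hcoeff := congrArg (coeff m) hscale
  rw [coeff_scaleVariables, mul_eq_left₀ (mem_support_iff.1 hm), Fintype.prod_sum_type,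
    Fintype.prod_eq_single j (by simp +contextual [d]),
    Fintype.prod_eq_single j (by simp +contextual [d])] at hcoeff
  simp only [Sum.elim_inl, Sum.elim_inr, d, if_true] at hcoeff
  refine hζ.pow_inj (by lia) (by lia) ?_
  calc
    ζ ^ m (Sum.inl j) = ζ ^ m (Sum.inl j) * (ζ * star ζ) ^ m (Sum.inr j) := by
        rw [hζ1, one_pow, mul_one]
    _ = ζ ^ m (Sum.inl j) * star ζ ^ m (Sum.inr j) * ζ ^ m (Sum.inr j) := by ring
    _ = _ := by rw [hcoeff, one_mul]

/-- Stabilizer-invariant bihomogeneous polynomials are combinations of zonal monomials. -/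
theorem IsStabilizerInvariant.exists_eq_zonalSum {o j : ι} (hj : j ≠ o) {b c : ℕ}
    {P : MvPolynomial (ι ⊕ ι) ℂ} (hP : IsStabilizerInvariant o P)
    (hb : IsWeightedHomogeneous (Sum.elim (fun _ => 1) fun _ => 0 : ι ⊕ ι → ℕ) P b)
    (hc : IsWeightedHomogeneous (Sum.elim (fun _ => 0) fun _ => 1 : ι ⊕ ι → ℕ) P c) :
    ∃ a, P = zonalSum o b c a := by
  have hplane : ∀ (x : ℂ) (s : ℝ) (a : ℕ → ℂ),
      eval (Sum.elim (Pi.single o x + Pi.single j (s : ℂ))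
        fun i => star ((Pi.single o x + Pi.single j (s : ℂ) : ι → ℂ) i)) (zonalSum o b c a) =
      ∑ k ∈ Finset.range (min b c + 1), a k * (x ^ (b - k) * star x ^ (c - k) * (s * s) ^ k) := by
    intro x s a
    simp only [zonalSum, zonalMonomial, map_sum, map_mul, map_pow, eval_offAxisForm, eval_X,
      Sum.elim_inl, Sum.elim_inr, eval_C]
    simp [hj, hj.symm]
  have hterm : ∀ m ∈ P.support, ∃ a : ℕ → ℂ, ∀ (x : ℂ) (s : ℝ),
      P.coeff m * ∏ i, (Sum.elim (Pi.single o x + Pi.single j (s : ℂ))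
        fun i => star ((Pi.single o x + Pi.single j (s : ℂ) : ι → ℂ) i)) i ^ m i =
      ∑ k ∈ Finset.range (min b c + 1), a k * (x ^ (b - k) * star x ^ (c - k) * (s * s) ^ k) := by
    intro m hm
    by_cases hsupp : ∃ i, i ≠ o ∧ i ≠ j ∧ m (Sum.inl i) ≠ 0
    · obtain ⟨i, hio, hij, hi⟩ := hsupp
      refine ⟨0, fun x s => ?_⟩
      rw [Finset.prod_eq_zero (Finset.mem_univ (Sum.inl i))]
      · simp
      · simp [hio, hij, hi]
    push Not at hsupp
    have hsupp' : ∀ i, i ≠ o ∧ i ≠ j → m (Sum.inr i) = 0 := fun i hi => by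
      rw [← hP.inl_eq_inr hi.1 hm, hsupp i hi.1 hi.2]
    have hmj := hP.inl_eq_inr hj hm
    have hmb := hb (mem_support_iff.1 hm)
    have hmc := hc (mem_support_iff.1 hm)
    rw [Finsupp.weight_eq_sum, Fintype.sum_sum_type] at hmb hmc
    simp only [Sum.elim_inl, Sum.elim_inr, smul_eq_mul, mul_zero, mul_one,
      Finset.sum_const_zero, add_zero, zero_add] at hmb hmc
    rw [Fintype.sum_eq_add o j hj.symm fun i hi => hsupp i hi.1 hi.2] at hmb
    rw [Fintype.sum_eq_add o j hj.symm hsupp'] at hmc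
    refine ⟨Pi.single (m (Sum.inl j)) (P.coeff m), fun x s => ?_⟩
    rw [Finset.sum_eq_single_of_mem (m (Sum.inl j)) (Finset.mem_range.2 (by lia))
      (by simp +contextual), Pi.single_eq_same, Fintype.prod_sum_type,
      Fintype.prod_eq_mul o j hj.symm fun i hi => by rw [hsupp i hi.1 hi.2, pow_zero],
      Fintype.prod_eq_mul o j hj.symm fun i hi => by rw [hsupp' i hi, pow_zero],
      ← hmb, ← hmc, hmj, Nat.add_sub_cancel, Nat.add_sub_cancel]
    simp [hj, hj.symm]
    exact Or.inl (by ring)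
  choose! a ha using hterm
  refine ⟨fun k => ∑ m ∈ P.support, a m k, ?_⟩
  rw [← sub_eq_zero]
  refine eq_zero_of_eval_star_eq_zero fun v => ?_
  obtain ⟨A, hA, hAo, s, hv⟩ := exists_unitary_mulVec_eq hj v
  rw [map_sub, sub_eq_zero, ← hv, hP A hA hAo, eval_zonalSum_mulVec hA hAo, hplane, eval_eq',
    Finset.sum_congr rfl fun m hm => ha m hm _ _, Finset.sum_comm]
  simp only [Finset.sum_mul]

theorem laplacian_zonalSum_eq_zero_iff {o j : ι} (hj : j ≠ o) {b c : ℕ} {a : ℕ → ℂ} :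
    ∑ i, pderiv (Sum.inl i) (pderiv (Sum.inr i) (zonalSum o b c a)) = 0 ↔
      ∀ k < min b c, a k * ((b - k) * (c - k) : ℕ) +
        a (k + 1) * ((k + 1) * (k + (Fintype.card ι - 1)) : ℕ) = 0 := by
  rw [laplacian_zonalSum]
  refine ⟨fun h k hk => eq_zero_of_sum_zonalMonomial_eq_zero hj
    (d := fun k => a k * ((b - k) * (c - k) : ℕ) +
      a (k + 1) * ((k + 1) * (k + (Fintype.card ι - 1)) : ℕ)) h hk, fun h => ?_⟩
  exact Finset.sum_eq_zero fun k hk => by rw [h k (Finset.mem_range.1 hk), map_zero, zero_mul]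

end ZonalForms

/-- The coefficients of the zonal `□`-harmonic polynomial of bidegree `(b, c)` in `n` dimensions,
normalized to start with `1`. -/
noncomputable def zonalCoeff (n b c : ℕ) : ℕ → ℂ
  | 0 => 1
  | k + 1 => -(zonalCoeff n b c k * ((b - k) * (c - k) : ℕ)) / ((k + 1) * (k + (n - 1)) : ℕ)

theorem zonalCoeff_recurrence_iff {n b c N : ℕ} (hn : 2 ≤ n) {a : ℕ → ℂ} :
    (∀ k < N, a k * ((b - k) * (c - k) : ℕ) + a (k + 1) * ((k + 1) * (k + (n - 1)) : ℕ) = 0) ↔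
      ∀ k ≤ N, a k = a 0 * zonalCoeff n b c k := by
  have hne : ∀ k, (((k + 1) * (k + (n - 1)) : ℕ) : ℂ) ≠ 0 := fun k =>
    Nat.cast_ne_zero.2 (Nat.mul_ne_zero (by lia) (by lia))
  constructor
  · intro h k hk
    induction k with
    | zero => simp [zonalCoeff]
    | succ k ih =>
      rw [zonalCoeff, mul_div_assoc', eq_div_iff (hne k)]
      linear_combination h k hk - ((b - k) * (c - k) : ℕ) * ih (by lia)
  · intro h k hk
    rw [h k hk.le, h (k + 1) hk, zonalCoeff, mul_assoc _ (_ / _), div_mul_cancel₀ _ (hne k)]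
    ring

/-- The space of zonal `□`-harmonic polynomials of bidegree `(b, c)` — those invariant under
the subgroup of the unitary group fixing the first standard basis vector — is
one-dimensional. -/
theorem finrank_zonalBiharmonic (n b c : ℕ) (hn : 2 ≤ n) :
    Module.finrank ℂ
      (zonalBiharmonic n b c (Pi.single (⟨0, by omega⟩ : Fin n) 1)) = 1 := by
  set o : Fin n := ⟨0, by omega⟩
  have hj : (⟨1, by omega⟩ : Fin n) ≠ o := by simp [o]
  have hmem : zonalSum o b c (zonalCoeff n b c) ∈ zonalBiharmonic n b c (Pi.single o 1) := by
    refine ⟨?_, ?_, ?_, fun A hA hAo v => eval_zonalSum_mulVec hA hAo b c _ v⟩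
    · simpa using isWeightedHomogeneous_zonalSum o b c 1 0 (zonalCoeff n b c)
    · simpa using isWeightedHomogeneous_zonalSum o b c 0 1 (zonalCoeff n b c)
    · rw [laplacian_zonalSum_eq_zero_iff hj, Fintype.card_fin, zonalCoeff_recurrence_iff hn]
      simp [zonalCoeff]
  have hne : zonalSum o b c (zonalCoeff n b c) ≠ 0 := fun h =>
    one_ne_zero (eq_zero_of_sum_zonalMonomial_eq_zero hj h (Nat.succ_pos _))
  rw [finrank_eq_one_iff_of_nonzero' (⟨_, hmem⟩ : zonalBiharmonic n b c (Pi.single o 1))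
    (by simpa using hne)]
  rintro ⟨P, hb, hc, hbox, hinv⟩
  obtain ⟨a, rfl⟩ := IsStabilizerInvariant.exists_eq_zonalSum hj hinv hb hc
  rw [laplacian_zonalSum_eq_zero_iff hj, Fintype.card_fin, zonalCoeff_recurrence_iff hn] at hbox
  refine ⟨a 0, Subtype.ext ?_⟩
  simp only [SetLike.mk_smul_mk, zonalSum, smul_eq_C_mul, Finset.mul_sum]
  refine Finset.sum_congr rfl fun k hk => ?_
  rw [hbox k (Nat.lt_succ_iff.1 (Finset.mem_range.1 hk)), map_mul, mul_assoc]
end
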